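/- Fix p ∈ (0,1). For each n ≥ 2 let d_n ∈ ℕ with 1 ≤ d_n ≤ n−1, with n·d_n even, and suppose lim_{n→∞} d_n/n = p. Let μ_mic^n be the uniform probability distribution on the (nonempty) set of d_n-regular simple graphs on Fin n, and let μ_can^n be the Erdős–Rényi measure G(n, d_n/(n−1)). Let E_mic^n[λ1] and E_can^n[λ1] denote the expectations of the largest adjacency eigenvalue λ1 under these two measures. Then lim_{n→∞} ( E_can^n[λ1] − E_mic^n[λ1] ) = 1 − p. -/

import Mathlib

open scoped Classical
open Finset

/-- The real adjacency matrix of a simple graph on `Fin n`. -/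
noncomputable def adjMat {n : ℕ} (g : SimpleGraph (Fin n)) : Matrix (Fin n) (Fin n) ℝ :=
  g.adjMatrix ℝ

/-- The number of edges of a simple graph on `Fin n`. -/
noncomputable def edgeCount {n : ℕ} (g : SimpleGraph (Fin n)) : ℕ := g.edgeFinset.card

/-- The Erdős–Rényi `G(n,p)` probability of a single graph `g`:
`p ^ m (1-p) ^ (C(n,2) - m)` where `m` is the number of edges of `g`. -/
noncomputable def erWeight (n : ℕ) (p : ℝ) (g : SimpleGraph (Fin n)) : ℝ :=
  p ^ edgeCount g * (1 - p) ^ (n.choose 2 - edgeCount g)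

/-- The Erdős–Rényi `G(n,p)` expectation of a functional `f` of the graph. -/
noncomputable def erExp (n : ℕ) (p : ℝ) (f : SimpleGraph (Fin n) → ℝ) : ℝ :=
  ∑ g : SimpleGraph (Fin n), erWeight n p g * f g

/-- The largest eigenvalue of a real matrix, as the supremum of its spectrum. -/
noncomputable def lam1 {n : ℕ} (M : Matrix (Fin n) (Fin n) ℝ) : ℝ := sSup (spectrum ℝ M)

/-- The expectation of a functional `f` under the uniform distribution on a finite
set `Γ` of graphs (the microcanonical ensemble). -/
noncomputable def micExp {n : ℕ} (Γ : Finset (SimpleGraph (Fin n)))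
    (f : SimpleGraph (Fin n) → ℝ) : ℝ :=
  (∑ g ∈ Γ, f g) / (Γ.card : ℝ)

section EigenvalueBounds

open Matrix

variable {n : ℕ}

theorem Matrix.IsHermitian.lam1_mem_spectrum [NeZero n] {M : Matrix (Fin n) (Fin n) ℝ}
    (hM : M.IsHermitian) : lam1 M ∈ spectrum ℝ M := by
  have h := hM.spectrum_real_eq_range_eigenvalues
  unfold lam1
  refine Set.Nonempty.csSup_mem ?_ ?_
  · rw [h]; exact Set.range_nonempty _
  · rw [h]; exact Set.finite_range _

theorem Matrix.IsHermitian.exists_lam1_eigenvector [NeZero n] {M : Matrix (Fin n) (Fin n) ℝ}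
    (hM : M.IsHermitian) : ∃ x : Fin n → ℝ, x ≠ 0 ∧ M *ᵥ x = lam1 M • x := by
  have h := hM.lam1_mem_spectrum
  rw [← Matrix.spectrum_toLin', ← Module.End.hasEigenvalue_iff_mem_spectrum] at h
  obtain ⟨x, hx⟩ := h.exists_hasEigenvector
  exact ⟨x, hx.2, by simpa using hx.apply_eq_smul⟩

theorem Matrix.IsHermitian.dotProduct_mulVec_le_lam1 {M : Matrix (Fin n) (Fin n) ℝ}
    (hM : M.IsHermitian) (x : Fin n → ℝ) : x ⬝ᵥ M *ᵥ x ≤ lam1 M * (x ⬝ᵥ x) := by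
  have hfin : (spectrum ℝ M).Finite := by
    rw [hM.spectrum_real_eq_range_eigenvalues]; exact Set.finite_range _
  have hH : (algebraMap ℝ (Matrix (Fin n) (Fin n) ℝ) (lam1 M) - M).IsHermitian := by
    refine Matrix.IsHermitian.sub ?_ hM
    rw [Algebra.algebraMap_eq_smul_one]
    simp [Matrix.IsHermitian]
  have hpos : (algebraMap ℝ (Matrix (Fin n) (Fin n) ℝ) (lam1 M) - M).PosSemidef := by
    rw [Matrix.posSemidef_iff_isHermitian_and_spectrum_nonneg]
    refine ⟨hH, fun t ht => ?_⟩
    rw [← spectrum.singleton_sub_eq] at ht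
    obtain ⟨a, ha, b, hb, rfl⟩ := ht
    rw [Set.mem_singleton_iff] at ha
    subst ha
    exact sub_nonneg.2 (le_csSup hfin.bddAbove hb)
  have := hpos.dotProduct_mulVec_nonneg x
  simp only [star_trivial, Matrix.sub_mulVec, dotProduct_sub, Algebra.algebraMap_eq_smul_one,
    Matrix.smul_mulVec, Matrix.one_mulVec, dotProduct_smul, smul_eq_mul] at this
  linarith

theorem Matrix.IsHermitian.lam1_le [NeZero n] {M : Matrix (Fin n) (Fin n) ℝ}
    (hM : M.IsHermitian) {c : ℝ} (h : ∀ x : Fin n → ℝ, x ⬝ᵥ M *ᵥ x ≤ c * (x ⬝ᵥ x)) :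
    lam1 M ≤ c := by
  obtain ⟨x, hx0, hx⟩ := hM.exists_lam1_eigenvector
  have := h x
  rw [hx, dotProduct_smul, smul_eq_mul] at this
  have hpos : 0 < x ⬝ᵥ x := by
    refine lt_of_le_of_ne (by simpa using dotProduct_star_self_nonneg x) ?_
    intro h0
    exact hx0 (dotProduct_self_eq_zero.1 h0.symm)
  exact le_of_mul_le_mul_right this hpos

theorem dotProduct_sq_le (x y : Fin n → ℝ) : (x ⬝ᵥ y) ^ 2 ≤ (x ⬝ᵥ x) * (y ⬝ᵥ y) := by
  have := Finset.sum_mul_sq_le_sq_mul_sq Finset.univ x y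
  simpa [dotProduct, sq] using this

theorem dotProduct_self_nonneg' (x : Fin n → ℝ) : 0 ≤ x ⬝ᵥ x := by
  simpa using dotProduct_star_self_nonneg x

theorem mulVec_dotProduct_self_le (B : Matrix (Fin n) (Fin n) ℝ) (y : Fin n → ℝ) :
    (B *ᵥ y) ⬝ᵥ (B *ᵥ y) ≤ (∑ i, ∑ j, B i j ^ 2) * (y ⬝ᵥ y) := by
  rw [Finset.sum_mul]
  unfold dotProduct
  refine Finset.sum_le_sum fun i _ => ?_
  have := dotProduct_sq_le (B i) y
  simpa [mulVec, dotProduct, sq] using this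

theorem mulVec_dotProduct_comm {B : Matrix (Fin n) (Fin n) ℝ} (hB : B.IsSymm)
    (x y : Fin n → ℝ) : (B *ᵥ x) ⬝ᵥ y = x ⬝ᵥ (B *ᵥ y) := by
  rw [dotProduct_mulVec, ← mulVec_transpose, hB.eq]

theorem mulVec_dotProduct_self_le_of_sq {B : Matrix (Fin n) (Fin n) ℝ} (hB : B.IsSymm)
    {β : ℝ} (h : ∑ i, ∑ j, (B * B) i j ^ 2 ≤ β ^ 4) (y : Fin n → ℝ) :
    (B *ᵥ y) ⬝ᵥ (B *ᵥ y) ≤ β ^ 2 * (y ⬝ᵥ y) := by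
  have hy := dotProduct_self_nonneg' y
  refine le_of_sq_le_sq ?_ (by positivity)
  rw [mulVec_dotProduct_comm hB, mulVec_mulVec]
  calc _ ≤ _ := dotProduct_sq_le _ _
    _ ≤ (y ⬝ᵥ y) * ((∑ i, ∑ j, (B * B) i j ^ 2) * (y ⬝ᵥ y)) := by
      gcongr; exact mulVec_dotProduct_self_le _ _
    _ ≤ (y ⬝ᵥ y) * (β ^ 4 * (y ⬝ᵥ y)) := by gcongr
    _ = _ := by ring

theorem abs_dotProduct_mulVec_le_of_sq {B : Matrix (Fin n) (Fin n) ℝ} (hB : B.IsSymm)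
    {β : ℝ} (hβ : 0 ≤ β) (h : ∑ i, ∑ j, (B * B) i j ^ 2 ≤ β ^ 4) (y : Fin n → ℝ) :
    |y ⬝ᵥ (B *ᵥ y)| ≤ β * (y ⬝ᵥ y) := by
  have hy := dotProduct_self_nonneg' y
  refine abs_le_of_sq_le_sq ?_ (by positivity)
  calc _ ≤ _ := dotProduct_sq_le _ _
    _ ≤ (y ⬝ᵥ y) * (β ^ 2 * (y ⬝ᵥ y)) := by
      gcongr; exact mulVec_dotProduct_self_le_of_sq hB h y
    _ = _ := by ring

theorem rank_one_add_quadratic_le {B : Matrix (Fin n) (Fin n) ℝ} (hB : B.IsSymm) (hn : 0 < n)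
    {β q α : ℝ} (hβ : ∀ y : Fin n → ℝ, y ⬝ᵥ (B *ᵥ y) ≤ β * (y ⬝ᵥ y))
    (hα : α = q * n + (1 ⬝ᵥ (B *ᵥ 1)) / n) (hαβ : β < α) (x : Fin n → ℝ) :
    q * (1 ⬝ᵥ x) ^ 2 + x ⬝ᵥ (B *ᵥ x) ≤
      (α + (B *ᵥ 1) ⬝ᵥ (B *ᵥ 1) / (n * (α - β))) * (x ⬝ᵥ x) := by
  have hn' : (0 : ℝ) < n := by exact_mod_cast hn
  obtain ⟨t, y, hy, rfl⟩ : ∃ (t : ℝ) (y : Fin n → ℝ), 1 ⬝ᵥ y = 0 ∧ x = t • 1 + y := by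
    refine ⟨(1 ⬝ᵥ x) / n, x - ((1 ⬝ᵥ x) / n) • 1, ?_, by simp⟩
    rw [dotProduct_sub, dotProduct_smul, one_dotProduct_one]
    simp; field_simp; ring
  have h11 : (1 : Fin n → ℝ) ⬝ᵥ 1 = n := by simp
  set b := B *ᵥ (1 : Fin n → ℝ) with hb
  have hbb := dotProduct_self_nonneg' b
  have hyy := dotProduct_self_nonneg' y
  have e1 : 1 ⬝ᵥ (t • (1 : Fin n → ℝ) + y) = t * n := by
    rw [dotProduct_add, dotProduct_smul, h11, hy]; simp
  have e2 : (t • (1 : Fin n → ℝ) + y) ⬝ᵥ (t • (1 : Fin n → ℝ) + y) = n * t ^ 2 + y ⬝ᵥ y := by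
    simp only [dotProduct_add, add_dotProduct, dotProduct_smul, smul_dotProduct, h11, hy,
      dotProduct_comm y 1, smul_eq_mul]
    ring
  have e3 : (t • (1 : Fin n → ℝ) + y) ⬝ᵥ (B *ᵥ (t • (1 : Fin n → ℝ) + y))
      = t ^ 2 * (1 ⬝ᵥ b) + 2 * t * (y ⬝ᵥ b) + y ⬝ᵥ (B *ᵥ y) := by
    have : 1 ⬝ᵥ (B *ᵥ y) = y ⬝ᵥ b := by
      rw [← mulVec_dotProduct_comm hB, dotProduct_comm]
    simp only [mulVec_add, mulVec_smul, dotProduct_add, add_dotProduct, dotProduct_smul,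
      smul_dotProduct, this, ← hb, smul_eq_mul]
    ring
  rw [e1, e2, e3]
  have hS : 1 ⬝ᵥ b = (α - q * n) * n := by rw [hα]; field_simp; ring
  have h0 := dotProduct_self_nonneg' (t • b - (α - β) • y)
  simp only [dotProduct_sub, sub_dotProduct, dotProduct_smul, smul_dotProduct, smul_eq_mul,
    dotProduct_comm b y] at h0
  have hδ : 0 < α - β := by linarith
  have h1 : 2 * t * (y ⬝ᵥ b) ≤ t ^ 2 * (b ⬝ᵥ b) / (α - β) + (α - β) * (y ⬝ᵥ y) := by
    rw [← sub_le_iff_le_add, le_div_iff₀ hδ]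
    nlinarith
  have h2 := hβ y
  have h3 : (n * t ^ 2) * (b ⬝ᵥ b / (n * (α - β))) = t ^ 2 * (b ⬝ᵥ b) / (α - β) := by
    field_simp
  have h4 : 0 ≤ b ⬝ᵥ b / (n * (α - β)) * (y ⬝ᵥ y) := by positivity
  rw [hS]
  nlinarith

theorem le_of_rank_one_add_quadratic_le {B : Matrix (Fin n) (Fin n) ℝ}
    (hn : 0 < n) {q μ α : ℝ} (hα : α = q * n + (1 ⬝ᵥ (B *ᵥ 1)) / n)
    (hμ : ∀ x : Fin n → ℝ, q * (1 ⬝ᵥ x) ^ 2 + x ⬝ᵥ (B *ᵥ x) ≤ μ * (x ⬝ᵥ x)) : α ≤ μ := by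
  have hn' : (0 : ℝ) < n := by exact_mod_cast hn
  have h := hμ 1
  have h11 : (1 : Fin n → ℝ) ⬝ᵥ 1 = n := by simp
  rw [h11] at h
  refine le_of_mul_le_mul_right ?_ hn'
  rw [hα]
  field_simp
  linarith

theorem add_le_of_rank_one_add_quadratic_le {B : Matrix (Fin n) (Fin n) ℝ} (hB : B.IsSymm)
    (hn : 0 < n) {q μ α ε : ℝ} (hq : 0 < q) (hε : 0 ≤ ε)
    (hα : α = q * n + (1 ⬝ᵥ (B *ᵥ 1)) / n)
    (hβ : ∑ i, ∑ j, (B * B) i j ^ 2 ≤ (ε * n) ^ 4)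
    (hμ : ∀ x : Fin n → ℝ, q * (1 ⬝ᵥ x) ^ 2 + x ⬝ᵥ (B *ᵥ x) ≤ μ * (x ⬝ᵥ x)) :
    α + (1 - 2 * ε / q) / (1 + ε ^ 2 / q ^ 2) *
      (((B *ᵥ 1) ⬝ᵥ (B *ᵥ 1) - (1 ⬝ᵥ (B *ᵥ 1)) ^ 2 / n) / (q * n ^ 2)) ≤ μ := by
  have hn' : (0 : ℝ) < n := by exact_mod_cast hn
  have h11 : (1 : Fin n → ℝ) ⬝ᵥ 1 = n := by simp
  have hqf := abs_dotProduct_mulVec_le_of_sq hB (by positivity) hβ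
  have hop := mulVec_dotProduct_self_le_of_sq hB hβ 1
  have hS := hqf 1
  have hαμ := le_of_rank_one_add_quadratic_le hn hα hμ
  set b := B *ᵥ (1 : Fin n → ℝ) with hb
  set S := 1 ⬝ᵥ b with hSdef
  rw [h11] at hop hS
  set z := b - (S / n) • (1 : Fin n → ℝ) with hz
  have h1z : 1 ⬝ᵥ z = 0 := by
    rw [hz, dotProduct_sub, dotProduct_smul, h11, ← hSdef]
    simp; field_simp; ring
  have hzz : z ⬝ᵥ z = b ⬝ᵥ b - S ^ 2 / n := by
    have : z ⬝ᵥ z = z ⬝ᵥ b := by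
      conv_lhs => rw [hz, ← hz, dotProduct_sub, dotProduct_smul, dotProduct_comm z 1, h1z]
      simp
    rw [this, hz, sub_dotProduct, smul_dotProduct, ← hSdef, smul_eq_mul]
    ring
  have hzb : z ⬝ᵥ b = z ⬝ᵥ z := by
    conv_rhs => rw [hz, ← hz, dotProduct_sub, dotProduct_smul, dotProduct_comm z 1, h1z]
    simp
  have hzz0 := dotProduct_self_nonneg' z
  set w := z ⬝ᵥ z with hw
  have hqz := (abs_le.1 (hqf z)).1
  have hbb : w ≤ ε ^ 2 * n ^ 3 := by
    rw [hzz]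
    have : 0 ≤ S ^ 2 / n := by positivity
    nlinarith
  have hαu : α ≤ (q + ε) * n := by
    rw [hα]
    have := (abs_le.1 hS).2
    have : S / n ≤ ε * n := by rw [div_le_iff₀ hn']; linarith
    linarith
  set c := 1 / (q * n) with hc
  have hc0 : 0 < c := by positivity
  have hx := hμ ((1 : Fin n → ℝ) + c • z)
  have e1 : 1 ⬝ᵥ ((1 : Fin n → ℝ) + c • z) = n := by rw [dotProduct_add, dotProduct_smul, h1z, h11]; simp
  have e2 : ((1 : Fin n → ℝ) + c • z) ⬝ᵥ ((1 : Fin n → ℝ) + c • z) = n + c ^ 2 * w := by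
    simp only [dotProduct_add, add_dotProduct, dotProduct_smul, smul_dotProduct, h11, h1z,
      dotProduct_comm z 1, smul_eq_mul, ← hw]
    ring
  have e3 : ((1 : Fin n → ℝ) + c • z) ⬝ᵥ (B *ᵥ ((1 : Fin n → ℝ) + c • z)) = S + 2 * c * w + c ^ 2 * (z ⬝ᵥ (B *ᵥ z)) := by
    have : 1 ⬝ᵥ (B *ᵥ z) = z ⬝ᵥ b := by
      rw [← mulVec_dotProduct_comm hB, dotProduct_comm]
    simp only [mulVec_add, mulVec_smul, dotProduct_add, add_dotProduct, dotProduct_smul,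
      smul_dotProduct, this, ← hb, smul_eq_mul, hzb, ← hSdef]
    ring
  rw [e1, e2, e3] at hx
  have hSα : S = (α - q * n) * n := by rw [hα]; field_simp; ring
  have hcn : c * (q * n) = 1 := by rw [hc]; field_simp
  have key : c * w * (1 - 2 * ε / q) ≤ (μ - α) * (n + c ^ 2 * w) := by
    have h1 : (α + ε * n) * c ≤ 1 + 2 * ε / q := by
      rw [hc, mul_one_div, div_le_iff₀ (by positivity)]
      have : (1 + 2 * ε / q) * (q * n) = (q + 2 * ε) * n := by field_simp
      rw [this]; nlinarith
    have h2 : c * w * ((α + ε * n) * c) ≤ c * w * (1 + 2 * ε / q) := by gcongr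
    have h3 : -(c ^ 2 * (ε * n * w)) ≤ c ^ 2 * (z ⬝ᵥ (B *ᵥ z)) := by
      have := mul_le_mul_of_nonneg_left hqz (sq_nonneg c)
      linarith
    nlinarith
  have hden : c ^ 2 * w ≤ ε ^ 2 / q ^ 2 * n := by
    have : ε ^ 2 / q ^ 2 * n = c ^ 2 * (ε ^ 2 * n ^ 3) := by rw [hc]; field_simp
    rw [this]; gcongr
  have key2 : c * w * (1 - 2 * ε / q) ≤ (μ - α) * ((1 + ε ^ 2 / q ^ 2) * n) := by
    refine key.trans (mul_le_mul_of_nonneg_left ?_ (by linarith))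
    linarith
  rw [← hzz]
  have e4 : (1 - 2 * ε / q) / (1 + ε ^ 2 / q ^ 2) * (w / (q * n ^ 2)) =
      c * w * (1 - 2 * ε / q) / ((1 + ε ^ 2 / q ^ 2) * n) := by
    rw [hc]
    have : (1 + ε ^ 2 / q ^ 2) ≠ 0 := by positivity
    field_simp
  have := (div_le_iff₀ (by positivity : 0 < (1 + ε ^ 2 / q ^ 2) * n)).2 key2
  linarith

section ErdosRenyi

variable {q : ℝ}

theorem erExp_add (f h : SimpleGraph (Fin n) → ℝ) :
    erExp n q (fun g => f g + h g) = erExp n q f + erExp n q h := by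
  simp [erExp, mul_add, Finset.sum_add_distrib]

theorem erExp_sub (f h : SimpleGraph (Fin n) → ℝ) :
    erExp n q (fun g => f g - h g) = erExp n q f - erExp n q h := by
  simp [erExp, mul_sub, Finset.sum_sub_distrib]

theorem erExp_const_mul (c : ℝ) (f : SimpleGraph (Fin n) → ℝ) :
    erExp n q (fun g => c * f g) = c * erExp n q f := by
  simp [erExp, Finset.mul_sum, mul_left_comm]

theorem erExp_sum {ι : Type*} (s : Finset ι) (f : ι → SimpleGraph (Fin n) → ℝ) :
    erExp n q (fun g => ∑ i ∈ s, f i g) = ∑ i ∈ s, erExp n q (f i) := by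
  simp only [erExp, Finset.mul_sum]
  exact Finset.sum_comm

theorem erWeight_nonneg (h0 : 0 ≤ q) (h1 : q ≤ 1) (g : SimpleGraph (Fin n)) :
    0 ≤ erWeight n q g :=
  mul_nonneg (pow_nonneg h0 _) (pow_nonneg (sub_nonneg.2 h1) _)

theorem erExp_mono (h0 : 0 ≤ q) (h1 : q ≤ 1) {f h : SimpleGraph (Fin n) → ℝ}
    (hfh : ∀ g, f g ≤ h g) : erExp n q f ≤ erExp n q h :=
  Finset.sum_le_sum fun g _ => mul_le_mul_of_nonneg_left (hfh g) (erWeight_nonneg h0 h1 g)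

theorem sum_erWeight (n : ℕ) (q : ℝ) : ∑ g : SimpleGraph (Fin n), erWeight n q g = 1 := by
  have h := Finset.sum_pow_mul_eq_add_pow q (1 - q) (⊤ : SimpleGraph (Fin n)).edgeFinset
  rw [add_sub_cancel, one_pow] at h
  rw [← h]
  refine Finset.sum_bij (fun g _ => g.edgeFinset) ?_ ?_ ?_ ?_
  · intro g _
    rw [Finset.mem_powerset]
    exact SimpleGraph.edgeFinset_mono le_top
  · intro a _ b _ hab
    exact SimpleGraph.edgeFinset_inj.1 hab
  · intro s hs
    rw [Finset.mem_powerset] at hs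
    refine ⟨SimpleGraph.fromEdgeSet (s : Set (Sym2 (Fin n))), Finset.mem_univ _, ?_⟩
    ext e
    simp only [SimpleGraph.mem_edgeFinset, SimpleGraph.edgeSet_fromEdgeSet, Set.mem_sdiff,
      Finset.mem_coe, and_iff_left_iff_imp]
    intro he
    have := hs he
    rw [SimpleGraph.mem_edgeFinset] at this
    exact SimpleGraph.not_isDiag_of_mem_edgeSet _ this
  · intro g _
    have : #(⊤ : SimpleGraph (Fin n)).edgeFinset = n.choose 2 := by
      rw [SimpleGraph.card_edgeFinset_top_eq_card_choose_two, Fintype.card_fin]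
    rw [this]
    rfl

theorem erExp_const (c : ℝ) : erExp n q (fun _ => c) = c := by
  rw [erExp, ← Finset.sum_mul, sum_erWeight, one_mul]

/-- The graph obtained from `g` by switching the status of the pair `{i, j}`. -/
def toggleEdge (i j : Fin n) (g : SimpleGraph (Fin n)) : SimpleGraph (Fin n) :=
  symmDiff g (SimpleGraph.edge i j)

theorem toggleEdge_adj (i j : Fin n) (g : SimpleGraph (Fin n)) (a b : Fin n) :
    (toggleEdge i j g).Adj a b ↔ Xor (g.Adj a b) ((SimpleGraph.edge i j).Adj a b) := by
  simp [toggleEdge, symmDiff, Xor]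

theorem toggleEdge_toggleEdge (i j : Fin n) (g : SimpleGraph (Fin n)) :
    toggleEdge i j (toggleEdge i j g) = g :=
  symmDiff_symmDiff_cancel_right _ _

/-- The adjacency matrix of `g` with every off-diagonal entry shifted by `-q`. -/
noncomputable def centeredAdj (q : ℝ) (g : SimpleGraph (Fin n)) : Matrix (Fin n) (Fin n) ℝ :=
  Matrix.of fun i j => if i = j then 0 else adjMat g i j - q

theorem centeredAdj_self (g : SimpleGraph (Fin n)) (i : Fin n) : centeredAdj q g i i = 0 := by
  simp [centeredAdj]

theorem centeredAdj_of_ne (g : SimpleGraph (Fin n)) {i j : Fin n} (h : i ≠ j) :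
    centeredAdj q g i j = (if g.Adj i j then 1 else 0) - q := by
  simp [centeredAdj, h, adjMat, SimpleGraph.adjMatrix_apply]

theorem centeredAdj_comm (g : SimpleGraph (Fin n)) (i j : Fin n) :
    centeredAdj q g i j = centeredAdj q g j i := by
  by_cases h : i = j
  · rw [h]
  · rw [centeredAdj_of_ne g h, centeredAdj_of_ne g (Ne.symm h), g.adj_comm]

theorem centeredAdj_isSymm (g : SimpleGraph (Fin n)) : (centeredAdj q g).IsSymm :=
  Matrix.IsSymm.ext fun i j => centeredAdj_comm g j i

theorem abs_centeredAdj_le (h0 : 0 ≤ q) (h1 : q ≤ 1) (g : SimpleGraph (Fin n)) (i j : Fin n) :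
    |centeredAdj q g i j| ≤ 1 := by
  by_cases h : i = j
  · subst h; simp [centeredAdj_self]
  · rw [centeredAdj_of_ne g h, abs_le]
    split_ifs <;> constructor <;> linarith

theorem centeredAdj_sq (g : SimpleGraph (Fin n)) {i j : Fin n} (h : i ≠ j) :
    centeredAdj q g i j ^ 2 = q * (1 - q) + (1 - 2 * q) * centeredAdj q g i j := by
  rw [centeredAdj_of_ne g h]
  split_ifs <;> ring

theorem centeredAdj_toggleEdge {i j a b : Fin n} (h : s(a, b) ≠ s(i, j))
    (g : SimpleGraph (Fin n)) : centeredAdj q (toggleEdge i j g) a b = centeredAdj q g a b := by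
  by_cases hab : a = b
  · subst hab; simp [centeredAdj_self]
  · have : (toggleEdge i j g).Adj a b ↔ g.Adj a b := by
      rw [toggleEdge_adj, SimpleGraph.edge_adj]
      simp only [ne_eq, Sym2.eq_iff] at h
      simp [h, Xor]
    rw [centeredAdj_of_ne _ hab, centeredAdj_of_ne _ hab, this]

theorem edgeCount_eq_card (g : SimpleGraph (Fin n)) [Fintype g.edgeSet] :
    edgeCount g = #g.edgeFinset := by
  unfold edgeCount
  congr 1
  ext e
  simp only [SimpleGraph.mem_edgeFinset]

theorem erWeight_sup_edge {i j : Fin n} (hij : i ≠ j) {g : SimpleGraph (Fin n)}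
    (h : ¬ g.Adj i j) :
    erWeight n q (g ⊔ SimpleGraph.edge i j) * (1 - q) = erWeight n q g * q := by
  have hc : edgeCount (g ⊔ SimpleGraph.edge i j) = edgeCount g + 1 := by
    rw [edgeCount_eq_card, edgeCount_eq_card, g.card_edgeFinset_sup_edge h hij]
  have hle : edgeCount (g ⊔ SimpleGraph.edge i j) ≤ n.choose 2 := by
    have := SimpleGraph.card_edgeFinset_le_card_choose_two (G := g ⊔ SimpleGraph.edge i j)
    rw [Fintype.card_fin] at this
    rwa [edgeCount_eq_card]
  rw [erWeight, erWeight, hc]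
  rw [hc] at hle
  obtain ⟨k, hk⟩ := Nat.exists_eq_add_of_le hle
  have h1 : n.choose 2 - (edgeCount g + 1) = k := by omega
  have h2 : n.choose 2 - edgeCount g = k + 1 := by omega
  rw [h1, h2]
  ring

theorem erExp_centeredAdj_mul {i j : Fin n} (hij : i ≠ j) {F : SimpleGraph (Fin n) → ℝ}
    (hF : ∀ g, F (toggleEdge i j g) = F g) :
    erExp n q (fun g => centeredAdj q g i j * F g) = 0 := by
  have hadj (g : SimpleGraph (Fin n)) : (toggleEdge i j g).Adj i j ↔ ¬ g.Adj i j := by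
    rw [toggleEdge_adj, SimpleGraph.edge_adj]; simp [hij, Xor]
  have key (g : SimpleGraph (Fin n)) (hg : ¬ g.Adj i j) :
      erWeight n q g * (centeredAdj q g i j * F g) + erWeight n q (toggleEdge i j g) *
        (centeredAdj q (toggleEdge i j g) i j * F (toggleEdge i j g)) = 0 := by
    have ht : toggleEdge i j g = g ⊔ SimpleGraph.edge i j := by
      refine Disjoint.symmDiff_eq_sup ?_

      rwa [SimpleGraph.disjoint_edge]
    rw [hF, centeredAdj_of_ne _ hij, centeredAdj_of_ne _ hij, hadj, if_neg hg, if_pos hg, ht]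
    linear_combination F g * erWeight_sup_edge (q := q) hij hg
  refine Finset.sum_involution (fun g _ => toggleEdge i j g) ?_ ?_ ?_ ?_
  · intro g _
    by_cases hg : g.Adj i j
    · have := key (toggleEdge i j g) (by rw [hadj]; simpa using hg)
      rw [toggleEdge_toggleEdge] at this
      rw [add_comm]; exact this
    · exact key g hg
  · intro g _ _ h
    have := hadj g
    rw [h] at this
    tauto
  · intro g _; exact Finset.mem_univ _
  · intro g _; exact toggleEdge_toggleEdge i j g

theorem erExp_centeredAdj (i j : Fin n) : erExp n q (fun g => centeredAdj q g i j) = 0 := by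
  by_cases h : i = j
  · subst h; simp [centeredAdj_self, erExp_const]
  · simpa using erExp_centeredAdj_mul (q := q) h (F := fun _ => 1) (fun _ => rfl)

theorem erExp_centeredAdj_sq {i j : Fin n} (h : i ≠ j) :
    erExp n q (fun g => centeredAdj q g i j ^ 2) = q * (1 - q) := by
  simp_rw [centeredAdj_sq _ h]
  rw [erExp_add, erExp_const, erExp_const_mul, erExp_centeredAdj, mul_zero, add_zero]

theorem erExp_centeredAdj_mul_of_ne {i j k l : Fin n} (h : s(k, l) ≠ s(i, j)) :
    erExp n q (fun g => centeredAdj q g i j * centeredAdj q g k l) = 0 := by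
  by_cases hij : i = j
  · subst hij; simp [centeredAdj_self, erExp_const]
  · exact erExp_centeredAdj_mul hij (centeredAdj_toggleEdge h)

theorem erExp_le_const (h0 : 0 ≤ q) (h1 : q ≤ 1) {f : SimpleGraph (Fin n) → ℝ} {c : ℝ}
    (h : ∀ g, f g ≤ c) : erExp n q f ≤ c :=
  (erExp_mono h0 h1 h).trans_eq (erExp_const c)

theorem erExp_sum_row_sq (n : ℕ) (q : ℝ) :
    erExp n q (fun g => (centeredAdj q g *ᵥ 1) ⬝ᵥ (centeredAdj q g *ᵥ 1)) =
      n * (n - 1) * (q * (1 - q)) := by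
  have h1 (g : SimpleGraph (Fin n)) : (centeredAdj q g *ᵥ 1) ⬝ᵥ (centeredAdj q g *ᵥ 1) =
      ∑ i, ∑ j, ∑ k, centeredAdj q g i j * centeredAdj q g i k := by
    simp [dotProduct, mulVec, Finset.sum_mul_sum]
  have h2 (i j k : Fin n) : erExp n q (fun g => centeredAdj q g i j * centeredAdj q g i k) =
      if k = j then (if j = i then 0 else q * (1 - q)) else 0 := by
    split_ifs with hkj hji
    · subst hji; simp [centeredAdj_self, erExp_const]
    · subst hkj; simpa [sq] using erExp_centeredAdj_sq (q := q) (Ne.symm hji)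
    · refine erExp_centeredAdj_mul_of_ne ?_
      simp only [ne_eq, Sym2.eq_iff]
      grind
  simp_rw [h1, erExp_sum, h2]
  simp only [Finset.sum_ite_eq', Finset.mem_univ, if_true]
  have h3 (i : Fin n) : ∑ j : Fin n, (if j = i then 0 else q * (1 - q)) =
      (n - 1) * (q * (1 - q)) := by
    have (j : Fin n) : (if j = i then 0 else q * (1 - q)) =
      q * (1 - q) - if j = i then q * (1 - q) else 0 := by split_ifs <;> simp
    simp_rw [this, Finset.sum_sub_distrib]
    simp; ring
  simp_rw [h3]
  simp; ring

theorem erExp_sum_entries (n : ℕ) (q : ℝ) :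
    erExp n q (fun g => 1 ⬝ᵥ (centeredAdj q g *ᵥ 1)) = 0 := by
  have h1 (g : SimpleGraph (Fin n)) : 1 ⬝ᵥ (centeredAdj q g *ᵥ 1) =
      ∑ i, ∑ j, centeredAdj q g i j := by
    simp [dotProduct, mulVec]
  simp_rw [h1, erExp_sum, erExp_centeredAdj]
  simp

theorem erExp_sum_entries_sq_le (h0 : 0 ≤ q) (h1 : q ≤ 1) (n : ℕ) :
    erExp n q (fun g => (1 ⬝ᵥ (centeredAdj q g *ᵥ 1)) ^ 2) ≤ 2 * n ^ 2 := by
  have e1 (g : SimpleGraph (Fin n)) : (1 ⬝ᵥ (centeredAdj q g *ᵥ 1)) ^ 2 =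
      ∑ i, ∑ k, ∑ j, ∑ l, centeredAdj q g i j * centeredAdj q g k l := by
    simp [dotProduct, mulVec, sq, Finset.sum_mul_sum]
  have e2 (i k j l : Fin n) : erExp n q (fun g => centeredAdj q g i j * centeredAdj q g k l) ≤
      (if k = i then if l = j then 1 else 0 else 0) +
        (if k = j then if l = i then 1 else 0 else 0) := by
    by_cases h : s(k, l) = s(i, j)
    · have hle : erExp n q (fun g => centeredAdj q g i j * centeredAdj q g k l) ≤ 1 := by
        refine erExp_le_const h0 h1 fun g => (le_abs_self _).trans ?_
        rw [abs_mul]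
        exact mul_le_one₀ (abs_centeredAdj_le h0 h1 g i j) (abs_nonneg _)
          (abs_centeredAdj_le h0 h1 g k l)
      refine hle.trans ?_
      rw [Sym2.eq_iff] at h
      rcases h with ⟨rfl, rfl⟩ | ⟨rfl, rfl⟩
      · simp only [if_true, le_add_iff_nonneg_right]; split_ifs <;> norm_num
      · simp only [if_true, le_add_iff_nonneg_left]; split_ifs <;> norm_num
    · rw [erExp_centeredAdj_mul_of_ne h]
      split_ifs <;> norm_num
  simp_rw [e1, erExp_sum]
  calc _ ≤ ∑ i : Fin n, ∑ k : Fin n, ∑ j : Fin n, ∑ l : Fin n,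
        (((if k = i then if l = j then 1 else 0 else 0) +
        (if k = j then if l = i then 1 else 0 else 0)) : ℝ) :=
        Finset.sum_le_sum fun i _ => Finset.sum_le_sum fun k _ => Finset.sum_le_sum fun j _ =>
          Finset.sum_le_sum fun l _ => e2 i k j l
    _ = 2 * n ^ 2 := by
      have (i k j : Fin n) : ∑ l : Fin n, (((if k = i then if l = j then 1 else 0 else 0) +
        (if k = j then if l = i then 1 else 0 else 0)) : ℝ) =
          (if k = i then 1 else 0) + (if k = j then 1 else 0) := by
        rw [Finset.sum_add_distrib]
        split_ifs <;> simp
      simp_rw [this, Finset.sum_add_distrib]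
      simp
      ring

theorem erExp_two_path_eq_zero {i j k₁ k₂ k₃ k₄ : Fin n} (hij : i ≠ j) (h2 : k₁ ≠ k₂)
    (h3 : k₁ ≠ k₃) (h4 : k₁ ≠ k₄) :
    erExp n q (fun g => (centeredAdj q g i k₁ * centeredAdj q g k₁ j) *
      (centeredAdj q g i k₂ * centeredAdj q g k₂ j) *
      (centeredAdj q g i k₃ * centeredAdj q g k₃ j) *
      (centeredAdj q g i k₄ * centeredAdj q g k₄ j)) = 0 := by
  by_cases hi : i = k₁
  · subst hi; simp [centeredAdj_self, erExp_const]
  by_cases hj : k₁ = j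
  · subst hj; simp [centeredAdj_self, erExp_const]
  simp_rw [mul_assoc]
  refine erExp_centeredAdj_mul hi fun g => ?_
  have a1 : centeredAdj q (toggleEdge i k₁ g) k₁ j = centeredAdj q g k₁ j :=
    centeredAdj_toggleEdge (by rw [ne_eq, Sym2.eq_iff]; grind) g
  have a2 (k : Fin n) (hk : k₁ ≠ k) :
      centeredAdj q (toggleEdge i k₁ g) i k = centeredAdj q g i k :=
    centeredAdj_toggleEdge (by rw [ne_eq, Sym2.eq_iff]; grind) g
  have a3 (k : Fin n) (hk : k₁ ≠ k) :
      centeredAdj q (toggleEdge i k₁ g) k j = centeredAdj q g k j :=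
    centeredAdj_toggleEdge (by rw [ne_eq, Sym2.eq_iff]; grind) g
  rw [a1, a2 _ h2, a2 _ h3, a2 _ h4, a3 _ h2, a3 _ h3, a3 _ h4]

theorem erExp_two_path_le (h0 : 0 ≤ q) (h1 : q ≤ 1) {i j : Fin n} (hij : i ≠ j)
    (k₁ k₂ k₃ k₄ : Fin n) :
    erExp n q (fun g => (centeredAdj q g i k₁ * centeredAdj q g k₁ j) *
      (centeredAdj q g i k₂ * centeredAdj q g k₂ j) *
      (centeredAdj q g i k₃ * centeredAdj q g k₃ j) *
      (centeredAdj q g i k₄ * centeredAdj q g k₄ j)) ≤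
    (if k₂ = k₁ then 1 else 0) * (if k₄ = k₃ then 1 else 0) +
      (if k₃ = k₁ then 1 else 0) * (if k₄ = k₂ then 1 else 0) +
      (if k₄ = k₁ then 1 else 0) * (if k₃ = k₂ then 1 else 0) := by
  by_cases hpair : (k₂ = k₁ ∧ k₄ = k₃) ∨ (k₃ = k₁ ∧ k₄ = k₂) ∨ (k₄ = k₁ ∧ k₃ = k₂)
  · refine (erExp_le_const (c := 1) h0 h1 fun g => (le_abs_self _).trans ?_).trans ?_
    · have hb (a b : Fin n) := abs_centeredAdj_le h0 h1 g a b
      simp only [abs_mul]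
      have hp (k : Fin n) : |centeredAdj q g i k| * |centeredAdj q g k j| ≤ 1 :=
        mul_le_one₀ (hb _ _) (abs_nonneg _) (hb _ _)
      exact mul_le_one₀ (mul_le_one₀ (mul_le_one₀ (hp _) (by positivity) (hp _))
        (by positivity) (hp _)) (by positivity) (hp _)
    · have hn (P : Prop) [Decidable P] : (0 : ℝ) ≤ if P then 1 else 0 := by
        split_ifs <;> norm_num
      rcases hpair with ⟨a, b⟩ | ⟨a, b⟩ | ⟨a, b⟩
      · rw [if_pos a, if_pos b]
        have := mul_nonneg (hn (k₃ = k₁)) (hn (k₄ = k₂))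
        have := mul_nonneg (hn (k₄ = k₁)) (hn (k₃ = k₂))
        linarith
      · rw [if_pos a, if_pos b]
        have := mul_nonneg (hn (k₂ = k₁)) (hn (k₄ = k₃))
        have := mul_nonneg (hn (k₄ = k₁)) (hn (k₃ = k₂))
        linarith
      · rw [if_pos a, if_pos b]
        have := mul_nonneg (hn (k₂ = k₁)) (hn (k₄ = k₃))
        have := mul_nonneg (hn (k₃ = k₁)) (hn (k₄ = k₂))
        linarith
  · refine le_trans (le_of_eq ?_) (by positivity : (0 : ℝ) ≤ _)
    have hcases : (k₁ ≠ k₂ ∧ k₁ ≠ k₃ ∧ k₁ ≠ k₄) ∨ (k₂ ≠ k₁ ∧ k₂ ≠ k₃ ∧ k₂ ≠ k₄) ∨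
        (k₃ ≠ k₁ ∧ k₃ ≠ k₂ ∧ k₃ ≠ k₄) ∨ (k₄ ≠ k₁ ∧ k₄ ≠ k₂ ∧ k₄ ≠ k₃) := by grind
    rcases hcases with ⟨a, b, c⟩ | ⟨a, b, c⟩ | ⟨a, b, c⟩ | ⟨a, b, c⟩
    · exact erExp_two_path_eq_zero hij a b c
    · rw [← erExp_two_path_eq_zero (q := q) hij a b c]
      congr 1; ext g; ring
    · rw [← erExp_two_path_eq_zero (q := q) hij a b c]
      congr 1; ext g; ring
    · rw [← erExp_two_path_eq_zero (q := q) hij a b c]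
      congr 1; ext g; ring

theorem sum_pow_four {ι : Type*} [Fintype ι] (f : ι → ℝ) :
    (∑ k, f k) ^ 4 = ∑ k₁, ∑ k₂, ∑ k₃, ∑ k₄, f k₁ * f k₂ * f k₃ * f k₄ := by
  simp_rw [← Finset.mul_sum, ← Finset.sum_mul, ← Finset.mul_sum, ← Finset.sum_mul,
    ← Finset.mul_sum, ← Finset.sum_mul]
  ring

theorem erExp_mul_self_entry_pow_four_le (h0 : 0 ≤ q) (h1 : q ≤ 1) {i j : Fin n}
    (hij : i ≠ j) :
    erExp n q (fun g => (centeredAdj q g * centeredAdj q g) i j ^ 4) ≤ 3 * n ^ 2 := by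
  have e1 (g : SimpleGraph (Fin n)) : (centeredAdj q g * centeredAdj q g) i j ^ 4 =
      ∑ k₁, ∑ k₂, ∑ k₃, ∑ k₄, (centeredAdj q g i k₁ * centeredAdj q g k₁ j) *
      (centeredAdj q g i k₂ * centeredAdj q g k₂ j) *
      (centeredAdj q g i k₃ * centeredAdj q g k₃ j) *
      (centeredAdj q g i k₄ * centeredAdj q g k₄ j) := by
    rw [Matrix.mul_apply]
    exact sum_pow_four _
  simp_rw [e1, erExp_sum]
  calc _ ≤ ∑ k₁ : Fin n, ∑ k₂ : Fin n, ∑ k₃ : Fin n, ∑ k₄ : Fin n,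
      (((if k₂ = k₁ then 1 else 0) * (if k₄ = k₃ then 1 else 0) +
      (if k₃ = k₁ then 1 else 0) * (if k₄ = k₂ then 1 else 0) +
      (if k₄ = k₁ then 1 else 0) * (if k₃ = k₂ then 1 else 0)) : ℝ) :=
        Finset.sum_le_sum fun i _ => Finset.sum_le_sum fun k _ => Finset.sum_le_sum fun j _ =>
          Finset.sum_le_sum fun l _ => erExp_two_path_le h0 h1 hij _ _ _ _
    _ = 3 * n ^ 2 := by
      simp_rw [Finset.sum_add_distrib, ← Finset.mul_sum]
      simp
      ring

/-- The sum of the squares of the off-diagonal entries of `B * B`. -/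
noncomputable def offDiagSqSum (B : Matrix (Fin n) (Fin n) ℝ) : ℝ :=
  ∑ x ∈ (Finset.univ : Finset (Fin n)).offDiag, (B * B) x.1 x.2 ^ 2

theorem offDiagSqSum_nonneg (B : Matrix (Fin n) (Fin n) ℝ) : 0 ≤ offDiagSqSum B :=
  Finset.sum_nonneg fun _ _ => sq_nonneg _

theorem erExp_offDiagSqSum_sq_le (h0 : 0 ≤ q) (h1 : q ≤ 1) (n : ℕ) :
    erExp n q (fun g => offDiagSqSum (centeredAdj q g) ^ 2) ≤ 3 * n ^ 6 := by
  have hcard : (#(Finset.univ : Finset (Fin n)).offDiag : ℝ) ≤ n ^ 2 := by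
    rw [Finset.offDiag_card, Finset.card_univ, Fintype.card_fin, sq]
    exact_mod_cast Nat.sub_le _ _
  have e1 (g : SimpleGraph (Fin n)) : offDiagSqSum (centeredAdj q g) ^ 2 ≤
      n ^ 2 * ∑ x ∈ (Finset.univ : Finset (Fin n)).offDiag,
        (centeredAdj q g * centeredAdj q g) x.1 x.2 ^ 4 := by
    refine (sq_sum_le_card_mul_sum_sq).trans ?_
    simp_rw [← pow_mul]
    exact mul_le_mul_of_nonneg_right hcard (Finset.sum_nonneg fun x _ => by rw [pow_mul]; positivity)
  refine (erExp_mono h0 h1 e1).trans ?_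
  rw [erExp_const_mul, erExp_sum]
  calc _ ≤ (n : ℝ) ^ 2 * ∑ x ∈ (Finset.univ : Finset (Fin n)).offDiag, (3 * n ^ 2 : ℝ) := by
        gcongr with x hx
        exact erExp_mul_self_entry_pow_four_le h0 h1 (Finset.mem_offDiag.1 hx).2.2
    _ = (n : ℝ) ^ 2 * (#(Finset.univ : Finset (Fin n)).offDiag * (3 * n ^ 2)) := by
        rw [Finset.sum_const, nsmul_eq_mul]
    _ ≤ (n : ℝ) ^ 2 * (n ^ 2 * (3 * n ^ 2)) := by gcongr
    _ = _ := by ring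

theorem sum_mul_self_sq_le {B : Matrix (Fin n) (Fin n) ℝ} (hB : ∀ i j, |B i j| ≤ 1) :
    ∑ i, ∑ j, (B * B) i j ^ 2 ≤ n ^ 3 + offDiagSqSum B := by
  rw [← Finset.sum_product', Finset.univ_product_univ, ← Finset.univ_product_univ,
    ← Finset.diag_union_offDiag, Finset.sum_union (Finset.disjoint_diag_offDiag _)]
  refine add_le_add ?_ le_rfl
  rw [Finset.sum_diag]
  have (i : Fin n) : (B * B) i i ^ 2 ≤ n ^ 2 := by
    refine sq_le_sq' ?_ ?_ <;> rw [Matrix.mul_apply]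
    · refine (?_ : (-n : ℝ) = ∑ _j : Fin n, (-1)).le.trans (Finset.sum_le_sum fun j _ => ?_)
      · simp
      · have := abs_mul (B i j) (B j i) ▸
          mul_le_one₀ (hB i j) (abs_nonneg _) (hB j i)
        exact (abs_le.1 this).1
    · refine (Finset.sum_le_sum fun j _ => ?_).trans (?_ : ∑ _j : Fin n, (1 : ℝ) = n).le
      · have := abs_mul (B i j) (B j i) ▸
          mul_le_one₀ (hB i j) (abs_nonneg _) (hB j i)
        exact (abs_le.1 this).2
      · simp
  refine (Finset.sum_le_sum fun i _ => this i).trans (le_of_eq ?_)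
  simp; ring

end ErdosRenyi

section Adjacency

theorem adjMat_isHermitian (g : SimpleGraph (Fin n)) : (adjMat g).IsHermitian := by
  rw [Matrix.IsHermitian, Matrix.conjTranspose_eq_transpose_of_trivial]
  exact SimpleGraph.transpose_adjMatrix (G := g) (α := ℝ)

theorem lam1_adjMat_le_of_degree_le [NeZero n] (g : SimpleGraph (Fin n)) {d : ℕ}
    (hd : ∀ v, g.degree v ≤ d) : lam1 (adjMat g) ≤ d := by
  refine (adjMat_isHermitian g).lam1_le fun x => ?_
  have hdeg (i : Fin n) : ∑ j, adjMat g i j = g.degree i := by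
    simp [adjMat, SimpleGraph.adjMatrix_apply, SimpleGraph.degree,
      SimpleGraph.neighborFinset_eq_filter]
  have hsymm (i j : Fin n) : adjMat g i j = adjMat g j i := (adjMat_isHermitian g).apply j i
  have h1 : x ⬝ᵥ adjMat g *ᵥ x = ∑ i, ∑ j, adjMat g i j * (x i * x j) := by
    simp only [dotProduct, mulVec, Finset.mul_sum]
    exact Finset.sum_congr rfl fun i _ => Finset.sum_congr rfl fun j _ => by ring
  have h2 : ∑ i, ∑ j, adjMat g i j * x j ^ 2 = ∑ i, ∑ j, adjMat g i j * x i ^ 2 := by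
    rw [Finset.sum_comm]
    exact Finset.sum_congr rfl fun i _ => Finset.sum_congr rfl fun j _ => by rw [hsymm]
  have h3 : ∑ i, ∑ j, adjMat g i j * x i ^ 2 ≤ d * (x ⬝ᵥ x) := by
    simp_rw [← Finset.sum_mul, hdeg, dotProduct, Finset.mul_sum, ← sq]
    gcongr with i
    exact hd i
  have h4 : 2 * ∑ i, ∑ j, adjMat g i j * (x i * x j) ≤
      ∑ i, ∑ j, adjMat g i j * x i ^ 2 + ∑ i, ∑ j, adjMat g i j * x j ^ 2 := by
    simp_rw [← Finset.sum_add_distrib, Finset.mul_sum]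
    gcongr with i _ j _
    have h0 : 0 ≤ adjMat g i j := by
      simp only [adjMat, SimpleGraph.adjMatrix_apply]; split_ifs <;> norm_num
    nlinarith [mul_nonneg h0 (sq_nonneg (x i - x j))]
  rw [h1]
  linarith

theorem lam1_adjMat_of_regular [NeZero n] (g : SimpleGraph (Fin n)) {d : ℕ}
    (hd : ∀ v, g.degree v = d) : lam1 (adjMat g) = d := by
  refine le_antisymm (lam1_adjMat_le_of_degree_le g fun v => (hd v).le) ?_
  have h := (adjMat_isHermitian g).dotProduct_mulVec_le_lam1 1
  have h1 : adjMat g *ᵥ 1 = fun _ => (d : ℝ) := by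
    ext i
    rw [← hd i]
    simp [adjMat, mulVec, dotProduct, SimpleGraph.adjMatrix_apply, SimpleGraph.degree,
      SimpleGraph.neighborFinset_eq_filter]
  rw [h1] at h
  have hn : (0 : ℝ) < n := by exact_mod_cast Nat.pos_of_neZero n
  simp [dotProduct] at h
  refine le_of_mul_le_mul_right ?_ hn
  linarith

theorem exists_regular_graph {d : ℕ} (hn : 2 ≤ n) (hd : d ≤ n - 1) (heven : Even (n * d)) :
    ∃ g : SimpleGraph (Fin n), ∀ v, g.degree v = d := by
  have : NeZero n := ⟨by omega⟩
  obtain ⟨k, hk⟩ : ∃ k, k = d / 2 := ⟨_, rfl⟩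
  let T : Finset (Fin n) := Finset.univ.filter fun x =>
    x.val ∈ Finset.Icc 1 k ∪ Finset.Ico (n - k) n ∪ if Odd d then {n / 2} else ∅
  have hodd : Odd d → 2 * (n / 2) = n := fun h => by
    rcases Nat.even_mul.1 heven with h' | h'
    · exact Nat.two_mul_div_two_of_even h'
    · exact absurd h' (Nat.not_even_iff_odd.2 h)
  have hT (x : Fin n) : x ∈ T ↔ (1 ≤ x.val ∧ x.val ≤ k) ∨ n - k ≤ x.val ∨
      (Odd d ∧ x.val = n / 2) := by
    have := x.2
    simp only [T, Finset.mem_filter, Finset.mem_univ, true_and, Finset.mem_union,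
      Finset.mem_Icc, Finset.mem_Ico]
    split_ifs with h <;> simp [h] <;> omega
  have hcard : #T = d := by
    have h1 : #T = #(T.map Fin.valEmbedding) := (Finset.card_map _).symm
    have h2 : T.map Fin.valEmbedding =
        Finset.Icc 1 k ∪ Finset.Ico (n - k) n ∪ if Odd d then {n / 2} else ∅ := by
      ext m
      simp only [T, Finset.mem_map, Finset.mem_filter, Finset.mem_univ, true_and,
        Fin.valEmbedding_apply]
      constructor
      · rintro ⟨x, hx, rfl⟩; exact hx
      · intro hm
        refine ⟨⟨m, ?_⟩, hm, rfl⟩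
        simp only [Finset.mem_union, Finset.mem_Icc, Finset.mem_Ico] at hm
        split_ifs at hm <;> simp at hm <;> omega
    rw [h1, h2, Finset.card_union_of_disjoint, Finset.card_union_of_disjoint, Nat.card_Icc,
      Nat.card_Ico]
    · split_ifs with h
      · have := Nat.odd_iff.1 h
        simp; omega
      · have := Nat.even_iff.1 (Nat.not_odd_iff_even.1 h)
        simp; omega
    · rw [Finset.disjoint_left]
      intro a; simp only [Finset.mem_Icc, Finset.mem_Ico]; omega
    · split_ifs with h
      · have := hodd h
        have := Nat.odd_iff.1 h
        simp only [Finset.disjoint_singleton_right, Finset.mem_union, Finset.mem_Icc,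
          Finset.mem_Ico]
        omega
      · exact Finset.disjoint_empty_right _
  have hneg (x : Fin n) (hx : x ∈ T) : -x ∈ T := by
    rw [hT] at hx ⊢
    have hlt := x.2
    have hx0 : x.val ≠ 0 := by
      rcases hx with h | h | ⟨h, h'⟩ <;> omega
    have hv : (-x).val = n - x.val := by
      rw [Fin.val_neg', Nat.mod_eq_of_lt (by omega)]
    rw [hv]
    rcases hx with h | h | ⟨h, h'⟩
    · omega
    · omega
    · have := hodd h
      exact Or.inr (Or.inr ⟨h, by omega⟩)
  have hzero : (0 : Fin n) ∉ T := by
    rw [hT]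
    simp only [Fin.val_zero]
    omega
  refine ⟨⟨fun u v => v - u ∈ T, ⟨fun u v h => ?_⟩, ⟨fun u h => ?_⟩⟩, fun v => ?_⟩
  · have := hneg _ h
    rwa [neg_sub] at this
  · rw [sub_self] at h
    exact hzero h
  · rw [← hcard, ← SimpleGraph.card_neighborFinset_eq_degree]
    refine Finset.card_bij (fun u _ => u - v) ?_ ?_ ?_
    · intro u hu
      rwa [SimpleGraph.mem_neighborFinset] at hu
    · intro a _ b _ h
      exact sub_left_injective h
    · intro x hx
      refine ⟨x + v, ?_, by simp⟩
      rw [SimpleGraph.mem_neighborFinset]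
      simpa using hx

theorem micExp_lam1_regular {d : ℕ} (hn : 2 ≤ n) (hd : d ≤ n - 1) (heven : Even (n * d)) :
    micExp (Finset.univ.filter fun g : SimpleGraph (Fin n) => ∀ v, g.degree v = d)
      (fun g => lam1 (adjMat g)) = d := by
  have : NeZero n := ⟨by omega⟩
  obtain ⟨g, hg⟩ := exists_regular_graph hn hd heven
  rw [micExp, Finset.sum_congr rfl (fun g hg => lam1_adjMat_of_regular g
    (Finset.mem_filter.1 hg).2), Finset.sum_const, nsmul_eq_mul]
  refine mul_div_cancel_left₀ _ ?_
  rw [Nat.cast_ne_zero, Finset.card_ne_zero]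
  exact ⟨g, by simpa using hg⟩

theorem dotProduct_adjMat_mulVec (q : ℝ) (g : SimpleGraph (Fin n)) (x : Fin n → ℝ) :
    x ⬝ᵥ (adjMat g *ᵥ x) + q * (x ⬝ᵥ x) = q * (1 ⬝ᵥ x) ^ 2 + x ⬝ᵥ (centeredAdj q g *ᵥ x) := by
  have h (i j : Fin n) : adjMat g i j =
      q + centeredAdj q g i j - if i = j then q else 0 := by
    by_cases hij : i = j
    · subst hij; simp [adjMat, centeredAdj_self]
    · simp [centeredAdj, hij]
  have e (i j : Fin n) : x i * ((q + centeredAdj q g i j - if i = j then q else 0) * x j) =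
      q * (x i * x j) + x i * (centeredAdj q g i j * x j) - if i = j then q * (x i * x j) else 0
      := by
    split_ifs <;> ring
  simp only [dotProduct, mulVec, h, Finset.mul_sum, e, Finset.sum_sub_distrib,
    Finset.sum_add_distrib, Finset.sum_ite_eq, Finset.mem_univ, if_true, Pi.one_apply, one_mul]
  rw [sq, Finset.sum_mul_sum, Finset.mul_sum]
  simp_rw [Finset.mul_sum]
  ring

end Adjacency

section Bounds

variable {q ε : ℝ}

theorem sum_mul_self_sq_le_of_offDiagSqSum_le {B : Matrix (Fin n) (Fin n) ℝ}
    (hB : ∀ i j, |B i j| ≤ 1) (hεn : 2 ≤ ε ^ 4 * n)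
    (h : offDiagSqSum B ≤ ε ^ 4 * n ^ 4 / 2) :
    ∑ i, ∑ j, (B * B) i j ^ 2 ≤ (ε * n) ^ 4 := by
  refine (sum_mul_self_sq_le hB).trans ?_
  have : (2 : ℝ) * n ^ 3 ≤ (ε ^ 4 * n) * n ^ 3 := by gcongr
  have : (ε * n) ^ 4 = (ε ^ 4 * n) * n ^ 3 := by ring
  nlinarith

theorem one_le_of_lt_offDiagSqSum {B : Matrix (Fin n) (Fin n) ℝ} (hn : 0 < n) (hε : 0 < ε)
    (h : ε ^ 4 * n ^ 4 / 2 < offDiagSqSum B) :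
    1 ≤ 4 / (ε ^ 8 * n ^ 8) * offDiagSqSum B ^ 2 := by
  have hn' : (0 : ℝ) < n := by exact_mod_cast hn
  rw [div_mul_eq_mul_div, le_div_iff₀ (by positivity)]
  have := pow_le_pow_left₀ (by positivity) h.le 2
  nlinarith

theorem row_sq_le_cube {B : Matrix (Fin n) (Fin n) ℝ} (hB : ∀ i j, |B i j| ≤ 1) :
    (B *ᵥ 1) ⬝ᵥ (B *ᵥ 1) ≤ (n : ℝ) ^ 3 := by
  refine (mulVec_dotProduct_self_le B 1).trans ?_
  have h1 : (1 : Fin n → ℝ) ⬝ᵥ 1 = n := by simp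
  have h2 : ∑ i, ∑ j, B i j ^ 2 ≤ (n : ℝ) ^ 2 := by
    refine (Finset.sum_le_sum fun i _ => Finset.sum_le_sum fun j _ =>
      (sq_le_one_iff_abs_le_one _).2 (hB i j)).trans (le_of_eq ?_)
    simp; ring
  rw [h1]
  calc _ ≤ (n : ℝ) ^ 2 * n := by gcongr
    _ = _ := by ring

theorem neg_sq_le_sum_entries {B : Matrix (Fin n) (Fin n) ℝ} (hB : ∀ i j, |B i j| ≤ 1) :
    -(n : ℝ) ^ 2 ≤ 1 ⬝ᵥ (B *ᵥ 1) := by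
  have h : 1 ⬝ᵥ (B *ᵥ 1) = ∑ i, ∑ j, B i j := by simp [dotProduct, mulVec]
  rw [h]
  calc -(n : ℝ) ^ 2 = ∑ _i : Fin n, ∑ _j : Fin n, (-1 : ℝ) := by simp; ring
    _ ≤ _ := Finset.sum_le_sum fun i _ => Finset.sum_le_sum fun j _ => (abs_le.1 (hB i j)).1

theorem lam1_adjMat_le (hn : 0 < n) (hq1 : q ≤ 1) (hε : 0 < ε) (hεq : 2 * ε < q)
    (hεn : 2 ≤ ε ^ 4 * n) (g : SimpleGraph (Fin n)) :
    lam1 (adjMat g) ≤ q * n - q + 1 / n * (1 ⬝ᵥ (centeredAdj q g *ᵥ 1)) +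
      1 / ((q - 2 * ε) * n ^ 2) * ((centeredAdj q g *ᵥ 1) ⬝ᵥ (centeredAdj q g *ᵥ 1)) +
      3 * n * (4 / (ε ^ 8 * n ^ 8) * offDiagSqSum (centeredAdj q g) ^ 2) := by
  have hn' : (0 : ℝ) < n := by exact_mod_cast hn
  have : NeZero n := ⟨hn.ne'⟩
  have hq0 : 0 < q := by linarith
  have hB := abs_centeredAdj_le hq0.le hq1 g
  have hrow := dotProduct_self_nonneg' (centeredAdj q g *ᵥ 1)
  have hδ : 0 < q - 2 * ε := by linarith
  have hR := offDiagSqSum_nonneg (centeredAdj q g)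
  rcases le_or_gt (offDiagSqSum (centeredAdj q g)) (ε ^ 4 * n ^ 4 / 2) with h | h
  · have hβ := sum_mul_self_sq_le_of_offDiagSqSum_le hB hεn h
    have hqf := abs_dotProduct_mulVec_le_of_sq (centeredAdj_isSymm g) (by positivity) hβ
    obtain ⟨α, hα⟩ : ∃ α, α = q * n + (1 ⬝ᵥ (centeredAdj q g *ᵥ 1)) / n := ⟨_, rfl⟩
    have h11 : (1 : Fin n → ℝ) ⬝ᵥ 1 = n := by simp
    have hS := (abs_le.1 (hqf 1)).1
    rw [h11] at hS
    have hS' : -(ε * n) ≤ (1 ⬝ᵥ (centeredAdj q g *ᵥ 1)) / n := by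
      rw [le_div_iff₀ hn']; linarith
    have hgap : (q - 2 * ε) * n ≤ α - ε * n := by rw [hα]; linarith
    have hgap0 : 0 < (q - 2 * ε) * n := by positivity
    have hmain : lam1 (adjMat g) ≤ α + (centeredAdj q g *ᵥ 1) ⬝ᵥ (centeredAdj q g *ᵥ 1) /
        (n * (α - ε * n)) - q := by
      refine (adjMat_isHermitian g).lam1_le fun x => ?_
      have := rank_one_add_quadratic_le (centeredAdj_isSymm g) hn
        (fun y => (abs_le.1 (hqf y)).2) hα (by linarith) x
      have := dotProduct_adjMat_mulVec q g x
      linarith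
    have h2 : (centeredAdj q g *ᵥ 1) ⬝ᵥ (centeredAdj q g *ᵥ 1) / (n * (α - ε * n)) ≤
        (centeredAdj q g *ᵥ 1) ⬝ᵥ (centeredAdj q g *ᵥ 1) / (n * ((q - 2 * ε) * n)) := by
      gcongr
    have h3 : (centeredAdj q g *ᵥ 1) ⬝ᵥ (centeredAdj q g *ᵥ 1) / (n * ((q - 2 * ε) * n)) =
      1 / ((q - 2 * ε) * n ^ 2) * ((centeredAdj q g *ᵥ 1) ⬝ᵥ (centeredAdj q g *ᵥ 1)) := by
      field_simp
    have h4 : 0 ≤ 3 * n * (4 / (ε ^ 8 * n ^ 8) * offDiagSqSum (centeredAdj q g) ^ 2) := by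
      positivity
    have h5 : (1 ⬝ᵥ (centeredAdj q g *ᵥ 1)) / n = 1 / n * (1 ⬝ᵥ (centeredAdj q g *ᵥ 1)) := by
      ring
    linarith
  · have h1 := one_le_of_lt_offDiagSqSum hn hε h
    have hl : lam1 (adjMat g) ≤ n := lam1_adjMat_le_of_degree_le g fun v => by
      have := g.degree_lt_card_verts v
      rw [Fintype.card_fin] at this
      exact this.le
    have hS : -(n : ℝ) ≤ 1 / n * (1 ⬝ᵥ (centeredAdj q g *ᵥ 1)) := by
      rw [one_div_mul_eq_div, le_div_iff₀ hn']
      linarith [neg_sq_le_sum_entries hB]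
    have h2 : 0 ≤ 1 / ((q - 2 * ε) * n ^ 2) *
        ((centeredAdj q g *ᵥ 1) ⬝ᵥ (centeredAdj q g *ᵥ 1)) := by positivity
    have h3 : 3 * (n : ℝ) * 1 ≤
      3 * n * (4 / (ε ^ 8 * n ^ 8) * offDiagSqSum (centeredAdj q g) ^ 2) := by gcongr
    have h4 : q ≤ q * n := le_mul_of_one_le_right hq0.le (by exact_mod_cast hn)
    linarith

theorem le_lam1_adjMat (hn : 0 < n) (hq1 : q ≤ 1) (hε : 0 < ε) (hεq : 2 * ε < q)
    (hεn : 2 ≤ ε ^ 4 * n) (g : SimpleGraph (Fin n)) :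
    q * n - q + 1 / n * (1 ⬝ᵥ (centeredAdj q g *ᵥ 1)) +
      (1 - 2 * ε / q) / (1 + ε ^ 2 / q ^ 2) *
      (1 / (q * n ^ 2) * ((centeredAdj q g *ᵥ 1) ⬝ᵥ (centeredAdj q g *ᵥ 1)) -
        1 / (q * n ^ 3) * (1 ⬝ᵥ (centeredAdj q g *ᵥ 1)) ^ 2) -
      n / q * (4 / (ε ^ 8 * n ^ 8) * offDiagSqSum (centeredAdj q g) ^ 2) ≤
    lam1 (adjMat g) := by
  have hn' : (0 : ℝ) < n := by exact_mod_cast hn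
  have hq0 : 0 < q := by linarith
  have hB := abs_centeredAdj_le hq0.le hq1 g
  have hR := offDiagSqSum_nonneg (centeredAdj q g)
  obtain ⟨α, hα⟩ : ∃ α, α = q * n + (1 ⬝ᵥ (centeredAdj q g *ᵥ 1)) / n := ⟨_, rfl⟩
  have hμ (x : Fin n → ℝ) : q * (1 ⬝ᵥ x) ^ 2 + x ⬝ᵥ (centeredAdj q g *ᵥ x) ≤
      (lam1 (adjMat g) + q) * (x ⬝ᵥ x) := by
    have h1 := (adjMat_isHermitian g).dotProduct_mulVec_le_lam1 x
    have h2 := dotProduct_adjMat_mulVec q g x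
    linarith
  have hκ0 : 0 ≤ 1 - 2 * ε / q := by
    rw [sub_nonneg, div_le_one hq0]; exact hεq.le
  have h5 : (1 ⬝ᵥ (centeredAdj q g *ᵥ 1)) / n = 1 / n * (1 ⬝ᵥ (centeredAdj q g *ᵥ 1)) := by
    ring
  rcases le_or_gt (offDiagSqSum (centeredAdj q g)) (ε ^ 4 * n ^ 4 / 2) with h | h
  · have hβ := sum_mul_self_sq_le_of_offDiagSqSum_le hB hεn h
    have hmain := add_le_of_rank_one_add_quadratic_le (centeredAdj_isSymm g) hn hq0 hε.le hα
      hβ hμ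
    have h4 : 0 ≤ n / q * (4 / (ε ^ 8 * n ^ 8) * offDiagSqSum (centeredAdj q g) ^ 2) := by
      positivity
    have h6 : ((centeredAdj q g *ᵥ 1) ⬝ᵥ (centeredAdj q g *ᵥ 1) -
        (1 ⬝ᵥ (centeredAdj q g *ᵥ 1)) ^ 2 / n) / (q * n ^ 2) =
        1 / (q * n ^ 2) * ((centeredAdj q g *ᵥ 1) ⬝ᵥ (centeredAdj q g *ᵥ 1)) -
        1 / (q * n ^ 3) * (1 ⬝ᵥ (centeredAdj q g *ᵥ 1)) ^ 2 := by
      field_simp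
    rw [h6] at hmain
    linarith
  · have h1 := one_le_of_lt_offDiagSqSum hn hε h
    have hαμ := le_of_rank_one_add_quadratic_le hn hα hμ
    have hκ1 : (1 - 2 * ε / q) / (1 + ε ^ 2 / q ^ 2) ≤ 1 := by
      rw [div_le_one (by positivity)]
      have : 0 ≤ 2 * ε / q := by positivity
      have : 0 ≤ ε ^ 2 / q ^ 2 := by positivity
      linarith
    have hκ0' : 0 ≤ (1 - 2 * ε / q) / (1 + ε ^ 2 / q ^ 2) := by positivity
    have h2 : 1 / (q * n ^ 2) * ((centeredAdj q g *ᵥ 1) ⬝ᵥ (centeredAdj q g *ᵥ 1)) -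
        1 / (q * n ^ 3) * (1 ⬝ᵥ (centeredAdj q g *ᵥ 1)) ^ 2 ≤ n / q := by
      have h7 : 0 ≤ 1 / (q * n ^ 3) * (1 ⬝ᵥ (centeredAdj q g *ᵥ 1)) ^ 2 := by positivity
      have h8 : 1 / (q * n ^ 2) * ((centeredAdj q g *ᵥ 1) ⬝ᵥ (centeredAdj q g *ᵥ 1)) ≤
          1 / (q * n ^ 2) * n ^ 3 := by
        gcongr
        exact row_sq_le_cube hB
      have h9 : 1 / (q * n ^ 2) * (n : ℝ) ^ 3 = n / q := by field_simp
      linarith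
    have h3 : n / q * 1 ≤ n / q * (4 / (ε ^ 8 * n ^ 8) *
        offDiagSqSum (centeredAdj q g) ^ 2) := by gcongr
    have h10 := (mul_le_mul_of_nonneg_left h2 hκ0').trans
      (mul_le_of_le_one_left (by positivity) hκ1)
    linarith

theorem erExp_lam1_le (hn : 0 < n) (hq1 : q ≤ 1) (hε : 0 < ε) (hεq : 2 * ε < q)
    (hεn : 2 ≤ ε ^ 4 * n) :
    erExp n q (fun g => lam1 (adjMat g)) - q * (n - 1) ≤
      (1 - 1 / n) * (q * (1 - q)) / (q - 2 * ε) + 36 * (1 / (ε ^ 8 * n)) := by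
  have hn' : (0 : ℝ) < n := by exact_mod_cast hn
  have hq0 : 0 < q := by linarith
  have hδ : q - 2 * ε ≠ 0 := by linarith
  have h := erExp_mono hq0.le hq1 (lam1_adjMat_le hn hq1 hε hεq hεn)
  simp only [erExp_add, erExp_const_mul, erExp_const, erExp_sum_entries, erExp_sum_row_sq] at h
  have h1 : 3 * n * (4 / (ε ^ 8 * n ^ 8) *
      erExp n q (fun g => offDiagSqSum (centeredAdj q g) ^ 2)) ≤
      3 * n * (4 / (ε ^ 8 * n ^ 8) * (3 * n ^ 6)) := by
    gcongr
    exact erExp_offDiagSqSum_sq_le hq0.le hq1 n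
  have h2 : 3 * n * (4 / (ε ^ 8 * n ^ 8) * (3 * n ^ 6)) = 36 * (1 / (ε ^ 8 * n)) := by
    field_simp; norm_num
  have h3 : 1 / ((q - 2 * ε) * n ^ 2) * (n * (n - 1) * (q * (1 - q))) =
      (1 - 1 / n) * (q * (1 - q)) / (q - 2 * ε) := by
    field_simp
  linarith

theorem le_erExp_lam1 (hn : 0 < n) (hq1 : q ≤ 1) (hε : 0 < ε) (hεq : 2 * ε < q)
    (hεn : 2 ≤ ε ^ 4 * n) :
    (1 - 2 * ε / q) / (1 + ε ^ 2 / q ^ 2) * ((1 - 1 / n) * (1 - q) - 2 / q * (1 / n)) -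
      12 / q * (1 / (ε ^ 8 * n)) ≤ erExp n q (fun g => lam1 (adjMat g)) - q * (n - 1) := by
  have hn' : (0 : ℝ) < n := by exact_mod_cast hn
  have hq0 : 0 < q := by linarith
  have hκ0 : 0 ≤ 1 - 2 * ε / q := by
    rw [sub_nonneg, div_le_one hq0]; exact hεq.le
  have h := erExp_mono hq0.le hq1 (le_lam1_adjMat hn hq1 hε hεq hεn)
  simp only [erExp_add, erExp_sub, erExp_const_mul, erExp_const, erExp_sum_entries,
    erExp_sum_row_sq] at h
  have h1 : n / q * (4 / (ε ^ 8 * n ^ 8) *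
      erExp n q (fun g => offDiagSqSum (centeredAdj q g) ^ 2)) ≤
      n / q * (4 / (ε ^ 8 * n ^ 8) * (3 * n ^ 6)) := by
    gcongr
    exact erExp_offDiagSqSum_sq_le hq0.le hq1 n
  have h2 : n / q * (4 / (ε ^ 8 * n ^ 8) * (3 * n ^ 6)) = 12 / q * (1 / (ε ^ 8 * n)) := by
    field_simp; norm_num
  have h3 : 1 / (q * n ^ 2) * (n * (n - 1) * (q * (1 - q))) = (1 - 1 / n) * (1 - q) := by
    field_simp
  have h4 : 1 / (q * n ^ 3) * erExp n q (fun g => (1 ⬝ᵥ (centeredAdj q g *ᵥ 1)) ^ 2) ≤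
      2 / q * (1 / n) := by
    calc _ ≤ 1 / (q * n ^ 3) * (2 * n ^ 2) := by
          gcongr
          exact erExp_sum_entries_sq_le hq0.le hq1 n
      _ = _ := by field_simp
  rw [h3] at h
  have h5 := mul_le_mul_of_nonneg_left (sub_le_sub_left h4 ((1 - 1 / (n : ℝ)) * (1 - q)))
    (by positivity : 0 ≤ (1 - 2 * ε / q) / (1 + ε ^ 2 / q ^ 2))
  linarith

end Bounds

end EigenvalueBounds

/-- Breaking of ensemble equivalence for the largest eigenvalue under the constraint
fixing all degrees.  Fix `p ∈ (0,1)`; for each `n` let `1 ≤ d n ≤ n-1` with `n * d n`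
even and `d n / n → p`.  Let the microcanonical ensemble be uniform on `d n`-regular
graphs and the canonical ensemble be `G(n, d n / (n-1))`.  Then the difference of the
expected largest adjacency eigenvalues tends to `1 - p`. -/
theorem degree_constraint_eigenvalue_ensemble_nonequivalence
    (p : ℝ) (hp : p ∈ Set.Ioo (0 : ℝ) 1)
    (d : ℕ → ℕ) (hd1 : ∀ n, 2 ≤ n → 1 ≤ d n) (hd2 : ∀ n, 2 ≤ n → d n ≤ n - 1)
    (heven : ∀ n, 2 ≤ n → Even (n * d n))
    (hlim : Filter.Tendsto (fun n => (d n : ℝ) / (n : ℝ)) Filter.atTop (nhds p)) :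
    Filter.Tendsto
      (fun n =>
        erExp n ((d n : ℝ) / ((n : ℝ) - 1)) (fun g => lam1 (adjMat g))
          - micExp
              (Finset.univ.filter fun g : SimpleGraph (Fin n) =>
                ∀ v, g.degree v = d n)
              (fun g => lam1 (adjMat g)))
      Filter.atTop (nhds (1 - p)) := by
  obtain ⟨hp0, hp1⟩ := hp
  have hninv : Filter.Tendsto (fun n : ℕ => 1 / (n : ℝ)) Filter.atTop (nhds 0) :=
    tendsto_one_div_atTop_nhds_zero_nat
  have hq : Filter.Tendsto (fun n : ℕ => (d n : ℝ) / ((n : ℝ) - 1)) Filter.atTop (nhds p) := by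
    have h := hlim.div (hninv.const_sub 1) (by norm_num)
    rw [sub_zero, div_one] at h
    refine h.congr' ?_
    filter_upwards [Filter.eventually_ge_atTop 2] with n hn
    have hn' : (2 : ℝ) ≤ n := by exact_mod_cast hn
    have : (n : ℝ) - 1 ≠ 0 := by linarith
    simp only [Pi.div_apply]
    field_simp
  let ε : ℕ → ℝ := fun n => (n : ℝ) ^ (-(1 / 16) : ℝ)
  have hε : Filter.Tendsto ε Filter.atTop (nhds 0) :=
    (tendsto_rpow_neg_atTop (by norm_num)).comp tendsto_natCast_atTop_atTop
  have hε4 : Filter.Tendsto (fun n : ℕ => ε n ^ 4 * n) Filter.atTop Filter.atTop := by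
    refine ((tendsto_rpow_atTop (by norm_num : (0 : ℝ) < 3 / 4)).comp
      tendsto_natCast_atTop_atTop).congr' ?_
    filter_upwards [Filter.eventually_gt_atTop 0] with n hn
    have hn' : (0 : ℝ) < n := by exact_mod_cast hn
    simp only [Function.comp, ε]
    rw [← Real.rpow_mul_natCast hn'.le, ← Real.rpow_add_one hn'.ne']
    norm_num
  have hε8 : Filter.Tendsto (fun n : ℕ => 1 / (ε n ^ 8 * n)) Filter.atTop (nhds 0) := by
    refine ((tendsto_rpow_neg_atTop (by norm_num : (0 : ℝ) < 1 / 2)).comp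
      tendsto_natCast_atTop_atTop).congr' ?_
    filter_upwards [Filter.eventually_gt_atTop 0] with n hn
    have hn' : (0 : ℝ) < n := by exact_mod_cast hn
    simp only [Function.comp, ε]
    rw [← Real.rpow_mul_natCast hn'.le, ← Real.rpow_add_one hn'.ne', one_div ((n : ℝ) ^ _),
      ← Real.rpow_neg hn'.le]
    norm_num
  have hupper := ((((hninv.const_sub 1).mul (hq.mul (hq.const_sub 1))).div
    (hq.sub (hε.const_mul 2)) (by simpa using hp0.ne')).add (hε8.const_mul 36))
  have hlower := (((((hε.const_mul 2).div hq hp0.ne').const_sub 1).div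
    (((hε.pow 2).div (hq.pow 2) (by positivity)).const_add 1) (by simp)).mul
    (((hninv.const_sub 1).mul (hq.const_sub 1)).sub
      ((tendsto_const_nhds.div hq hp0.ne' : Filter.Tendsto
        (fun n : ℕ => 2 / ((d n : ℝ) / ((n : ℝ) - 1))) Filter.atTop (nhds (2 / p))).mul hninv))).sub
      ((tendsto_const_nhds.div hq hp0.ne' : Filter.Tendsto
        (fun n : ℕ => 12 / ((d n : ℝ) / ((n : ℝ) - 1))) Filter.atTop (nhds (12 / p))).mul hε8)
  have hl : (1 - 2 * 0 / p) / (1 + 0 ^ 2 / p ^ 2) * ((1 - 0) * (1 - p) - 2 / p * 0) -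
      12 / p * 0 = 1 - p := by simp
  have hu : (1 - 0) * (p * (1 - p)) / (p - 2 * 0) + 36 * 0 = 1 - p := by
    simp [hp0.ne']
  rw [hl] at hlower
  rw [hu] at hupper
  have hev : ∀ᶠ n : ℕ in Filter.atTop, 2 ≤ n ∧ (d n : ℝ) / ((n : ℝ) - 1) ≤ 1 ∧ 0 < ε n ∧
      2 * ε n < (d n : ℝ) / ((n : ℝ) - 1) ∧ 2 ≤ ε n ^ 4 * n := by
    have h1 := (hε.const_mul 2).eventually_lt hq (by simpa using hp0)
    filter_upwards [Filter.eventually_ge_atTop 2, h1, hq.eventually_lt_const hp1,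
      hε4.eventually_ge_atTop 2] with n hn h1 h2 h3
    exact ⟨hn, h2.le, Real.rpow_pos_of_pos (by positivity) _, h1, h3⟩
  have hmic (n : ℕ) (hn : 2 ≤ n) :
      micExp (Finset.univ.filter fun g : SimpleGraph (Fin n) => ∀ v, g.degree v = d n)
        (fun g => lam1 (adjMat g)) = (d n : ℝ) / ((n : ℝ) - 1) * (n - 1) := by
    have hn' : (2 : ℝ) ≤ n := by exact_mod_cast hn
    rw [div_mul_cancel₀ _ (by linarith)]
    exact micExp_lam1_regular hn (hd2 n hn) (heven n hn)
  refine tendsto_of_tendsto_of_tendsto_of_le_of_le' hlower hupper ?_ ?_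
  · filter_upwards [hev] with n ⟨hn, hq1, hε0, hεq, hεn⟩
    rw [hmic n hn]
    exact le_erExp_lam1 (by omega) hq1 hε0 hεq hεn
  · filter_upwards [hev] with n ⟨hn, hq1, hε0, hεq, hεn⟩
    rw [hmic n hn]
    exact erExp_lam1_le (by omega) hq1 hε0 hεq hεn
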